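/- For every integer n and every vertex u of 𝕋 at generation n, the conditional probability under P that the spine passes through u given the first n generations of the tree satisfies P(ξ_n = u | 𝕋_n) = 1/Z_n; i.e. conditionally on 𝕋_n, ξ_n is uniformly distributed on the n-th generation. -/

import Mathlib

open MeasureTheory Filter Set

noncomputable section

/-- A configuration assigns to each Ulam–Harris label (a finite word on `ℕ`)
a number of children. A Galton–Watson tree is encoded by such a configuration. -/
abbrev Config : Type := List ℕ → ℕ

/-- `v` is a vertex of the tree encoded by the configuration `ω`:
every step of the path from the root is the index of a child of the previous vertex. -/
def memTree (ω : Config) (v : List ℕ) : Prop :=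
  ∀ k, (h : k < v.length) → v.get ⟨k, h⟩ < ω (v.take k)

/-- `Z ω u k` is the number of descendants of the vertex `u` at height `|u| + k`
in the tree encoded by `ω`. -/
def Z (ω : Config) (u : List ℕ) (k : ℕ) : ℕ :=
  Nat.card {v : List ℕ // v.length = k ∧ memTree ω (u ++ v)}

/-- `GW` is the law of the Galton–Watson tree with offspring distribution `q`:
under `GW` the numbers of children attached to the distinct labels
are i.i.d. with distribution `q`. -/
def IsGW (q : ℕ → ℝ) (GW : Measure Config) : Prop :=
  IsProbabilityMeasure GW ∧
    ∀ (S : Finset (List ℕ)) (g : List ℕ → ℕ),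
      GW {ω | ∀ u ∈ S, ω u = g u} = ∏ u ∈ S, ENNReal.ofReal (q (g u))

/-- The probability generating function `φ_n(x) = E[x^{Z_n}]` of the population
at height `n` under the measure `GW`. -/
def pgf (GW : Measure Config) (n : ℕ) (x : ℝ) : ℝ :=
  ∫ ω, x ^ (Z ω [] n) ∂GW

/-- The vertex at height `n` of the ray whose successive child choices are given by `ξ`. -/
def rayVertex (ξ : ℕ → ℕ) (n : ℕ) : List ℕ := List.ofFn (fun i : Fin n => ξ i)

/-- The generation at height `k` of the tree encoded by `t`. -/
def genSet (t : Config) (k : ℕ) : Set (List ℕ) := {v | v.length = k ∧ memTree t v}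

/-- The offspring distribution `q̃_ℓ = q_ℓ e^{1/c_k} e^{-ℓ/c_{k+1}}` of a vertex of
generation `k` off the spine. -/
def tq (q : ℕ → ℝ) (c : ℕ → ℝ) (k ℓ : ℕ) : ℝ :=
  q ℓ * Real.exp (1 / c k) * Real.exp (-(ℓ : ℝ) / c (k + 1))

/-- The offspring distribution
`q̃^s_ℓ = q_ℓ ℓ e^{-(ℓ-1)/c_{k+1}} φ'_k(φ_k^{-1}(s)) / φ'_{k+1}(φ_{k+1}^{-1}(s))`
of the spine vertex `ξ_k` at generation `k`. -/
def tqs (q : ℕ → ℝ) (c : ℕ → ℝ) (GW : Measure Config) (φinv : ℕ → ℝ → ℝ) (s : ℝ)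
    (k ℓ : ℕ) : ℝ :=
  q ℓ * (ℓ : ℝ) * Real.exp (-((ℓ : ℝ) - 1) / c (k + 1)) *
    (deriv (pgf GW k) (φinv k s) / deriv (pgf GW (k + 1)) (φinv (k + 1) s))

/-- `P` is the law of the marked tree `(𝕋, ξ)` of the spine construction:
conditionally on the first `k` generations `𝕋_k` and on the spine vertex `ξ_k`, the
numbers of children of the vertices at generation `k` are independent, the spine vertex
`ξ_k` having `ℓ` children with probability `tqs k ℓ`, every other vertex of generation `k`
having `ℓ` children with probability `tq k ℓ`, and `ξ_{k+1}` is chosen uniformly among the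
children of `ξ_k`.  Equivalently, the probability that the tree agrees with `t` up to
generation `n` and that the spine makes the choices `u 0, …, u (n-1)` is the product below. -/
def IsSpineLaw (tq' tqs' : ℕ → ℕ → ℝ) (P : Measure (Config × (ℕ → ℕ))) : Prop :=
  IsProbabilityMeasure P ∧
    ∀ (n : ℕ) (t : Config) (u : ℕ → ℕ), (∀ k < n, u k < t (rayVertex u k)) →
      P {p | (∀ v : List ℕ, v.length < n → memTree t v → p.1 v = t v) ∧
             (∀ k < n, p.2 k = u k)}
        = ∏ k ∈ Finset.range n,
            ENNReal.ofReal ((tqs' k (t (rayVertex u k)) / (t (rayVertex u k)))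
              * ∏ᶠ v ∈ (genSet t k \ {rayVertex u k}), tq' k (t v))

/-- trees agree below generation n -/
def agree (n : ℕ) (t t' : Config) : Prop := ∀ v : List ℕ, v.length < n → memTree t v → t' v = t v

lemma memTree_nil (t : Config) : memTree t [] := by intro k h; simp at h

lemma memTree_concat (t : Config) (v : List ℕ) (i : ℕ) :
    memTree t (v ++ [i]) ↔ memTree t v ∧ i < t v := by
  constructor
  · intro h
    refine ⟨fun k hk => ?_, ?_⟩
    · have := h k (by simp; omega)
      simpa [List.getElem_append_left hk, List.take_append_of_le_length hk.le] using this
    · have := h v.length (by simp)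
      simpa using this
  · rintro ⟨h, hi⟩ k hk
    rcases Nat.lt_or_ge k v.length with h1 | h1
    · have := h k h1
      simpa [List.getElem_append_left h1, List.take_append_of_le_length h1.le] using this
    · have : k = v.length := by simp at hk; omega
      subst this
      simpa using hi

lemma agree_memTree {n : ℕ} {t t' : Config} (h : agree n t t') (v : List ℕ) :
    v.length ≤ n → (memTree t' v ↔ memTree t v) := by
  induction v using List.reverseRecOn with
  | nil => intro _; simp [memTree_nil]
  | append_singleton v i ih =>
    intro hl
    simp at hl
    rw [memTree_concat, memTree_concat, ih (by omega)]
    constructor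
    · rintro ⟨a, b⟩; rw [h v (by omega) a] at b; exact ⟨a, b⟩
    · rintro ⟨a, b⟩; rw [← h v (by omega) a] at b; exact ⟨a, b⟩

lemma genSet_succ (t : Config) (n : ℕ) :
    genSet t (n+1) = ⋃ v ∈ genSet t n, (fun i => v ++ [i]) '' Set.Iio (t v) := by
  ext w
  simp only [genSet, Set.mem_setOf_eq, Set.mem_iUnion, Set.mem_image, Set.mem_Iio]
  constructor
  · rintro ⟨hl, hm⟩
    induction w using List.reverseRecOn with
    | nil => simp at hl
    | append_singleton v i ih =>
      rw [memTree_concat] at hm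
      exact ⟨v, ⟨by simpa using hl, hm.1⟩, i, hm.2, rfl⟩
  · rintro ⟨v, ⟨hl, hm⟩, i, hi, rfl⟩
    exact ⟨by simp [hl], (memTree_concat _ _ _).2 ⟨hm, hi⟩⟩

lemma genSet_zero (t : Config) : genSet t 0 = {[]} := by
  ext w
  simp only [genSet, Set.mem_setOf_eq, Set.mem_singleton_iff, List.length_eq_zero_iff]
  constructor
  · exact fun h => h.1
  · rintro rfl; exact ⟨rfl, memTree_nil t⟩

lemma genSet_finite (t : Config) (n : ℕ) : (genSet t n).Finite := by
  induction n with
  | zero => rw [genSet_zero]; exact Set.finite_singleton _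
  | succ n ih =>
    rw [genSet_succ]
    exact ih.biUnion fun v _ => (Set.finite_Iio _).image _

def G (t : Config) (n : ℕ) : Finset (List ℕ) := (genSet_finite t n).toFinset

lemma mem_G {t : Config} {n : ℕ} {v : List ℕ} : v ∈ G t n ↔ v.length = n ∧ memTree t v := by
  simp [G, genSet]

lemma G_zero (t : Config) : G t 0 = {[]} := by
  ext v; simp [G, genSet_zero]

lemma Z_eq (t : Config) (n : ℕ) : Z t [] n = (G t n).card := by
  have : Z t [] n = Nat.card (genSet t n) := rfl
  rw [this, Nat.card_coe_set_eq, Set.ncard_eq_toFinset_card _ (genSet_finite t n)]; rfl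

lemma G_succ (t : Config) (n : ℕ) :
    G t (n+1) = (G t n).biUnion fun v => (Finset.range (t v)).image fun i => v ++ [i] := by
  ext w
  simp only [G, Set.Finite.mem_toFinset, genSet_succ]
  simp

lemma card_G_succ (t : Config) (n : ℕ) : (G t (n+1)).card = ∑ v ∈ G t n, t v := by
  rw [G_succ, Finset.card_biUnion]
  · refine Finset.sum_congr rfl fun v _ => ?_
    rw [Finset.card_image_of_injective _ (fun i j h => by simpa using h), Finset.card_range]
  · intro v _ w _ hvw
    rw [Function.onFun, Finset.disjoint_left]
    intro a ha hb
    simp only [Finset.mem_image] at ha hb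
    obtain ⟨i, _, rfl⟩ := ha
    obtain ⟨j, _, hj⟩ := hb
    exact hvw (List.append_inj_left' hj rfl).symm

lemma agree_G {n : ℕ} {t t' : Config} (h : agree n t t') {k : ℕ} (hk : k ≤ n) :
    G t' k = G t k := by
  ext v
  rw [mem_G, mem_G]
  constructor
  · rintro ⟨a, b⟩; exact ⟨a, (agree_memTree h v (by omega)).1 b⟩
  · rintro ⟨a, b⟩; exact ⟨a, (agree_memTree h v (by omega)).2 b⟩

def below (t : Config) (n : ℕ) : Finset (List ℕ) := (Finset.range n).biUnion fun k => G t k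

lemma mem_below {t : Config} {n : ℕ} {v : List ℕ} : v ∈ below t n ↔ v.length < n ∧ memTree t v := by
  simp [below, mem_G]

open Classical in
def tr (k : ℕ) (t : Config) : List ℕ →₀ ℕ :=
  Finsupp.onFinset (below t k) (fun v => if v.length < k ∧ memTree t v then t v else 0)
    (by intro v hv; rw [mem_below]; by_contra h; simp [h] at hv)

lemma tr_apply {k : ℕ} {t : Config} {v : List ℕ} (h : v.length < k) (h' : memTree t v) :
    tr k t v = t v := by simp [tr, h, h']

lemma agree_iff_tr (k : ℕ) (t t' : Config) : agree k t t' ↔ tr k t' = tr k t := by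
  constructor
  · intro h
    ext v
    simp only [tr, Finsupp.onFinset_apply]
    by_cases hl : v.length < k
    · rw [agree_memTree h v hl.le]
      by_cases hm : memTree t v
      · simp [hl, hm, h v hl hm]
      · simp [hm]
    · simp [hl]
  · intro h
    have key : ∀ v : List ℕ, v.length < k → memTree t v → memTree t' v ∧ t' v = t v := by
      intro v
      have fin : ∀ v : List ℕ, v.length < k → memTree t v → memTree t' v → t' v = t v := by
        intro v h1 h2 h3
        rw [← tr_apply h1 h2, ← tr_apply h1 h3, h]
      induction v using List.reverseRecOn with
      | nil => intro h1 h2; exact ⟨memTree_nil _, fin _ h1 h2 (memTree_nil _)⟩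
      | append_singleton v i ih =>
        intro h1 h2
        have h3 := (memTree_concat _ _ _).1 h2
        obtain ⟨a, b⟩ := ih (by simp at h1; omega) h3.1
        have h4 : memTree t' (v ++ [i]) := (memTree_concat _ _ _).2 ⟨a, by rw [b]; exact h3.2⟩
        exact ⟨h4, fin _ h1 h2 h4⟩
    exact fun v h1 h2 => (key v h1 h2).2

lemma tsum_pi {ι : Type*} [Fintype ι] (f : ι → ℕ → ENNReal) (hf : ∀ v, ∑' l, f v l ≠ ⊤) :
    ∑' g : ι → ℕ, ∏ v, f v (g v) = ∏ v, ∑' l, f v l := by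
  classical
  let μ : ι → Measure ℕ := fun v => Measure.sum fun l => f v l • Measure.dirac l
  have h1 : ∀ v l, μ v {l} = f v l := by
    intro v l
    simp only [μ]
    rw [Measure.sum_apply _ (measurableSet_singleton l), tsum_eq_single l]
    · simp
    · intro b hb; simp [hb]
  have h2 : ∀ v, μ v Set.univ = ∑' l, f v l := by
    intro v
    simp [μ, Measure.sum_apply]
  have : ∀ v, IsFiniteMeasure (μ v) := fun v => ⟨by rw [h2]; exact (hf v).lt_top⟩
  have h3 : Measure.pi μ Set.univ = ∑' g : ι → ℕ, Measure.pi μ {g} := by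
    have := lintegral_countable' (μ := Measure.pi μ) (fun _ => 1)
    simpa using this
  rw [Measure.pi_univ] at h3
  simp only [Measure.pi_singleton, h1, h2] at h3
  exact h3.symm

open Classical in
/-- replace the offspring numbers of generation n -/
def md (t : Config) (n : ℕ) (g : G t n → ℕ) : Config :=
  fun v => if h : v ∈ G t n then g ⟨v, h⟩ else t v

lemma md_agree (t : Config) (n : ℕ) (g : G t n → ℕ) : agree n t (md t n g) := by
  intro v hl _
  have : v ∉ G t n := by rw [mem_G]; omega
  simp [md, this]

lemma md_apply (t : Config) (n : ℕ) (g : G t n → ℕ) (v : G t n) : md t n g v = g v := by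
  simp [md]

lemma md_apply' (t : Config) (n : ℕ) (g : G t n → ℕ) {v : List ℕ} (h : v.length < n) : 
    md t n g v = t v := by
  have : v ∉ G t n := by rw [mem_G]; omega
  simp [md, this]

lemma prod_md {M : Type*} [CommMonoid M] (t : Config) (n : ℕ) (g : G t n → ℕ) (F : ℕ → M) :
    ∏ v ∈ G (md t n g) n, F (md t n g v) = ∏ v : G t n, F (g v) := by
  rw [agree_G (md_agree t n g) le_rfl, ← Finset.prod_coe_sort]
  simp [md_apply]

def inTree (n : ℕ) (t : Config) (u : ℕ → ℕ) : Prop := ∀ k < n, u k < t (rayVertex u k)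

lemma rayVertex_succ (u : ℕ → ℕ) (n : ℕ) : rayVertex u (n+1) = rayVertex u n ++ [u n] := by
  unfold rayVertex
  rw [List.ofFn_succ_last]
  simp

lemma rayVertex_length (u : ℕ → ℕ) (n : ℕ) : (rayVertex u n).length = n := by
  simp [rayVertex]

lemma rayVertex_congr {u u' : ℕ → ℕ} {n : ℕ} : rayVertex u n = rayVertex u' n ↔ ∀ k < n, u k = u' k := by
  induction n with
  | zero => simp [rayVertex]
  | succ n ih =>
    rw [rayVertex_succ, rayVertex_succ]
    constructor
    · intro h
      have h1 := List.append_inj h (by simp [rayVertex_length])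
      intro k hk
      rcases Nat.lt_succ_iff_lt_or_eq.1 hk with h2 | rfl
      · exact ih.1 h1.1 k h2
      · simpa using h1.2
    · intro h
      rw [ih.2 fun k hk => h k (by omega), h n (by omega)]

lemma inTree_iff (n : ℕ) (t : Config) (u : ℕ → ℕ) : inTree n t u ↔ memTree t (rayVertex u n) := by
  induction n with
  | zero => simp [inTree, rayVertex, memTree_nil]
  | succ n ih =>
    rw [rayVertex_succ, memTree_concat, ← ih]
    constructor
    · exact fun h => ⟨fun k hk => h k (by omega), h n (by omega)⟩
    · rintro ⟨h1, h2⟩ k hk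
      rcases Nat.lt_succ_iff_lt_or_eq.1 hk with h3 | rfl
      · exact h1 k h3
      · exact h2

def Cy (n : ℕ) (t : Config) (u : ℕ → ℕ) : Set (Config × (ℕ → ℕ)) :=
  {p | (∀ v : List ℕ, v.length < n → memTree t v → p.1 v = t v) ∧ (∀ k < n, p.2 k = u k)}

lemma measurableSet_D (n : ℕ) (t : Config) : MeasurableSet {ω : Config | agree n t ω} := by
  have : {ω : Config | agree n t ω} = ⋂ v ∈ below t n, (fun ω : Config => ω v) ⁻¹' {t v} := by
    ext ω; simp [agree, mem_below]
  rw [this]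
  exact Finset.measurableSet_biInter _ fun v _ => measurable_pi_apply v (measurableSet_singleton _)

lemma measurableSet_ray (n : ℕ) (u : ℕ → ℕ) : MeasurableSet {x : ℕ → ℕ | ∀ k < n, x k = u k} := by
  have : {x : ℕ → ℕ | ∀ k < n, x k = u k} = ⋂ k ∈ Finset.range n, (fun ω : ℕ → ℕ => ω k) ⁻¹' {u k} := by
    ext ω; simp
  rw [this]
  exact Finset.measurableSet_biInter _ fun v _ => measurable_pi_apply v (measurableSet_singleton _)

lemma measurableSet_Cy (n : ℕ) (t : Config) (u : ℕ → ℕ) : MeasurableSet (Cy n t u) :=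
  (measurable_fst (measurableSet_D n t)).inter (measurable_snd (measurableSet_ray n u))

lemma null_of_fibers {Ω ι : Type*} [MeasurableSpace Ω] [Countable ι] (P : Measure Ω) (f : Ω → ι)
    (S N : Set Ω) (h : ∀ ω ∈ S, P ({x | f x = f ω} ∩ N) = 0) : P (S ∩ N) = 0 := by
  have h1 : S ∩ N ⊆ ⋃ i ∈ f '' S, ({x | f x = i} ∩ N) := by
    rintro x ⟨hx, hn⟩
    simp only [Set.mem_iUnion]
    exact ⟨f x, ⟨x, hx, rfl⟩, rfl, hn⟩
  refine measure_mono_null h1 ((measure_biUnion_null_iff (Set.to_countable _)).2 ?_)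
  rintro i ⟨ω, hω, rfl⟩
  exact h ω hω

section spine
variable (P : Measure (Config × (ℕ → ℕ))) [IsProbabilityMeasure P] (Q : ℕ → ℕ → ENNReal)
  (r : ℕ → ENNReal)

lemma spine_step
    (hlaw : ∀ n t u, inTree n t u →
      P (Cy n t u) = ∏ k ∈ Finset.range n, (r k * ∏ v ∈ G t k, Q k (t v)))
    (hQ : ∀ k, ∑' l, Q k l = 1) (hr : ∀ k, ∑' l : ℕ, r k * l * Q k l = 1)
    (n : ℕ) (t : Config) (u : ℕ → ℕ) (h : inTree n t u) :
    P (Cy n t u ∩ {p | ¬ inTree (n+1) p.1 p.2}) = 0 := by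
  classical
  have hray : rayVertex u n ∈ G t n := mem_G.2 ⟨rayVertex_length u n, (inTree_iff n t u).1 h⟩
  let ρ : G t n := ⟨rayVertex u n, hray⟩
  let B : (Σ g : G t n → ℕ, Fin (g ρ)) → Set (Config × (ℕ → ℕ)) :=
    fun x => Cy (n+1) (md t n x.1) (Function.update u n x.2)
  have hupd : ∀ i : ℕ, ∀ k ≤ n, rayVertex (Function.update u n i) k = rayVertex u k := by
    intro i k hk
    rw [rayVertex_congr]
    intro j hj
    rw [Function.update_of_ne (by omega)]
  have hin : ∀ x : (Σ g : G t n → ℕ, Fin (g ρ)), inTree (n+1) (md t n x.1) (Function.update u n x.2) := by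
    rintro ⟨g, i⟩
    rw [inTree_iff, rayVertex_succ, memTree_concat, hupd _ n le_rfl, Function.update_self]
    refine ⟨(agree_memTree (md_agree t n g) _ (rayVertex_length u n).le).2 ((inTree_iff n t u).1 h), ?_⟩
    rw [md_apply t n g ρ]
    exact i.2
  have hBC : ∀ x, B x ⊆ Cy n t u := by
    rintro ⟨g, i⟩ p ⟨h1, h2⟩
    refine ⟨fun v hv hm => ?_, fun k hk => ?_⟩
    · rw [h1 v (by omega) ((agree_memTree (md_agree t n g) _ hv.le).2 hm), md_apply' _ _ _ hv]
    · rw [h2 k (by omega), Function.update_of_ne (by omega)]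
  have hBg : ∀ x, ∀ p ∈ B x, (∀ v : G t n, p.1 v = x.1 v) ∧ p.2 n = x.2 := by
    rintro ⟨g, i⟩ p ⟨h1, h2⟩
    refine ⟨fun v => ?_, ?_⟩
    · have := mem_G.1 v.2
      rw [h1 v (by omega) ((agree_memTree (md_agree t n g) _ this.1.le).2 this.2), md_apply]
    · rw [h2 n (by omega), Function.update_self]
  have hBA : ∀ x, ∀ p ∈ B x, inTree (n+1) p.1 p.2 := by
    intro x p hp
    have h3 := (inTree_iff _ _ _).1 (hin x)
    rw [inTree_iff, rayVertex_congr.2 hp.2]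
    exact (agree_memTree (show agree (n+1) (md t n x.1) p.1 from hp.1) _ (rayVertex_length _ _).le).2 h3
  have hdisj : Pairwise (Function.onFun Disjoint B) := by
    rintro ⟨g, i⟩ ⟨g', i'⟩ hne
    rw [Function.onFun, Set.disjoint_left]
    intro p hp hp'
    have a := hBg _ p hp
    have b := hBg _ p hp'
    apply hne
    have hg : g = g' := by ext v; exact (a.1 v).symm.trans (b.1 v)
    subst hg
    have : i = i' := by ext; exact a.2.symm.trans b.2
    subst this
    rfl
  have hBm : ∀ x, P (B x) = P (Cy n t u) * (r n * ∏ v : G t n, Q n (x.1 v)) := by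
    intro x
    rw [hlaw _ _ _ (hin x), hlaw _ _ _ h, Finset.prod_range_succ, prod_md]
    congr 1
    refine Finset.prod_congr rfl fun k hk => ?_
    rw [Finset.mem_range] at hk
    rw [agree_G (md_agree t n x.1) hk.le]
    congr 1
    refine Finset.prod_congr rfl fun v hv => ?_
    rw [md_apply' _ _ _ (by rw [(mem_G.1 hv).1]; exact hk)]
  have hsum : P (⋃ x, B x) = P (Cy n t u) := by
    rw [measure_iUnion hdisj (fun x => measurableSet_Cy _ _ _)]
    simp only [hBm]
    rw [ENNReal.tsum_mul_left, ENNReal.tsum_sigma']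
    have : ∀ g : G t n → ℕ, ∑' _ : Fin (g ρ), (r n * ∏ v : G t n, Q n (g v))
        = ∏ v : G t n, ((if v = ρ then r n * (g v : ENNReal) else 1) * Q n (g v)) := by
      intro g
      rw [Finset.prod_mul_distrib, Finset.prod_ite_eq' Finset.univ ρ]
      simp
      ring
    refine (congrArg (P (Cy n t u) * ·) (tsum_congr this)).trans ?_
    have h5 : ∀ v : G t n, ∑' l : ℕ, ((if v = ρ then r n * (l : ENNReal) else 1) * Q n l) = 1 := by
      intro v
      by_cases hv : v = ρ
      · simp [hv, hr]
      · simp [hv, hQ]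
    rw [tsum_pi (fun v l => (if v = ρ then r n * (l : ENNReal) else 1) * Q n l)
      (fun v => by rw [h5]; simp)]
    rw [Finset.prod_congr rfl (fun v _ => h5 v), Finset.prod_const_one, mul_one]
  have hm : MeasurableSet (⋃ x, B x) := MeasurableSet.iUnion fun x => measurableSet_Cy _ _ _
  have hd := measure_sdiff (Set.iUnion_subset hBC) hm.nullMeasurableSet (measure_ne_top P _)
  rw [hsum, tsub_self] at hd
  refine measure_mono_null ?_ hd
  rintro p ⟨h1, h2⟩
  refine ⟨h1, fun h3 => ?_⟩
  obtain ⟨x, hx⟩ := Set.mem_iUnion.1 h3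
  exact h2 (hBA x p hx)

lemma spine_ae
    (hlaw : ∀ n t u, inTree n t u →
      P (Cy n t u) = ∏ k ∈ Finset.range n, (r k * ∏ v ∈ G t k, Q k (t v)))
    (hQ : ∀ k, ∑' l, Q k l = 1) (hr : ∀ k, ∑' l : ℕ, r k * l * Q k l = 1)
    (n : ℕ) : P {p | ¬ inTree n p.1 p.2} = 0 := by
  induction n with
  | zero => simp [inTree]
  | succ n ih =>
    have h1 := null_of_fibers P (fun p => (tr n p.1, rayVertex p.2 n)) {p | inTree n p.1 p.2}
      {p | ¬ inTree (n+1) p.1 p.2} (by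
        intro p hp
        rw [← spine_step P Q r hlaw hQ hr n p.1 p.2 hp]
        congr 2
        ext p'
        simp only [Prod.mk.injEq, ← agree_iff_tr, rayVertex_congr]
        rfl)
    refine measure_mono_null ?_ (measure_union_null ih h1)
    intro p hp
    by_cases h : inTree n p.1 p.2
    · exact Or.inr ⟨h, hp⟩
    · exact Or.inl h

lemma spine_final
    (hlaw : ∀ n t u, inTree n t u →
      P (Cy n t u) = ∏ k ∈ Finset.range n, (r k * ∏ v ∈ G t k, Q k (t v)))
    (hQ : ∀ k, ∑' l, Q k l = 1) (hr : ∀ k, ∑' l : ℕ, r k * l * Q k l = 1)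
    (n : ℕ) (t : Config) (u : List ℕ) (hu : u ∈ G t n) :
    P {p | agree n t p.1 ∧ rayVertex p.2 n = u}
      = ((Z t [] n : ENNReal))⁻¹ * P {p | agree n t p.1} := by
  have hset : ∀ u ∈ G t n, ∃ x : ℕ → ℕ, inTree n t x ∧
      {p : Config × (ℕ → ℕ) | agree n t p.1 ∧ rayVertex p.2 n = u} = Cy n t x := by
    intro u hu
    rw [mem_G] at hu
    have hx : rayVertex (fun i => u.getD i 0) n = u := by
      apply List.ext_getElem
      · simp [rayVertex, hu.1]
      · intro i h1 h2
        simp [rayVertex, h2]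
    refine ⟨fun i => u.getD i 0, ?_, ?_⟩
    · rw [inTree_iff, hx]; exact hu.2
    · ext p
      conv_lhs => rw [← hx]
      simp only [rayVertex_congr]
      rfl
  have hconst : ∀ u ∈ G t n, P {p | agree n t p.1 ∧ rayVertex p.2 n = u}
      = ∏ k ∈ Finset.range n, (r k * ∏ v ∈ G t k, Q k (t v)) := by
    intro u hu
    obtain ⟨x, hx, he⟩ := hset u hu
    rw [he, hlaw _ _ _ hx]
  have hE : P {p | agree n t p.1}
      = P (⋃ u ∈ G t n, {p | agree n t p.1 ∧ rayVertex p.2 n = u}) := by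
    apply le_antisymm
    · have h0 := spine_ae P Q r hlaw hQ hr n
      calc _ ≤ P ((⋃ u ∈ G t n, {p | agree n t p.1 ∧ rayVertex p.2 n = u})
              ∪ {p | ¬ inTree n p.1 p.2}) := by
            apply measure_mono
            intro p hp
            by_cases h : inTree n p.1 p.2
            · left
              simp only [Set.mem_iUnion]
              refine ⟨rayVertex p.2 n, mem_G.2 ⟨rayVertex_length _ _, ?_⟩, hp, rfl⟩
              exact (agree_memTree hp _ (rayVertex_length _ _).le).1 ((inTree_iff _ _ _).1 h)
            · right; exact h
        _ ≤ _ := by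
            refine (measure_union_le _ _).trans ?_
            rw [h0, add_zero]
    · apply measure_mono
      refine Set.iUnion₂_subset fun u _ p hp => hp.1
  rw [measure_biUnion_finset] at hE
  · rw [Finset.sum_congr rfl hconst, Finset.sum_const, nsmul_eq_mul, ← Z_eq] at hE
    rw [hE, hconst u hu, ← mul_assoc, ENNReal.inv_mul_cancel, one_mul]
    · rw [Z_eq]
      simpa using Finset.ne_empty_of_mem hu
    · simp
  · intro a _ b _ hab
    rw [Function.onFun, Set.disjoint_left]
    rintro p ⟨_, h1⟩ ⟨_, h2⟩
    exact hab (h1.symm.trans h2)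
  · intro u hu
    obtain ⟨x, hx, he⟩ := hset u hu
    rw [he]
    exact measurableSet_Cy _ _ _

end spine

lemma lintegral_fibers {Ω ι : Type*} [MeasurableSpace Ω] [Countable ι] (P : Measure Ω) (f : Ω → ι)
    (hf : ∀ ω, MeasurableSet {x | f x = f ω}) (h1 h2 : Ω → ENNReal)
    (h : ∀ ω, ∫⁻ x in {x | f x = f ω}, h1 x ∂P = ∫⁻ x in {x | f x = f ω}, h2 x ∂P) :
    ∫⁻ x, h1 x ∂P = ∫⁻ x, h2 x ∂P := by
  have hU : (⋃ i : ι, {x | f x = i}) = Set.univ := by ext x; simp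
  have hm : ∀ i, MeasurableSet {x | f x = i} := by
    intro i
    by_cases hi : ∃ ω, f ω = i
    · obtain ⟨ω, rfl⟩ := hi; exact hf ω
    · have : {x | f x = i} = ∅ := by
        ext x; simp only [Set.mem_ofPred_eq, Set.mem_empty_iff_false, iff_false]
        exact fun hx => hi ⟨x, hx⟩
      rw [this]; exact MeasurableSet.empty
  have hd : Pairwise (Function.onFun Disjoint fun i => {x | f x = i}) := by
    intro i j hij
    rw [Function.onFun, Set.disjoint_left]
    exact fun x hx hy => hij (Eq.trans (Eq.symm hx) hy)
  rw [← setLIntegral_univ, ← setLIntegral_univ h2, ← hU, lintegral_iUnion hm hd,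
    lintegral_iUnion hm hd]
  refine tsum_congr fun i => ?_
  by_cases hi : ∃ ω, f ω = i
  · obtain ⟨ω, rfl⟩ := hi; exact h ω
  · have : {x | f x = i} = ∅ := by
      ext x; simp only [Set.mem_ofPred_eq, Set.mem_empty_iff_false, iff_false]
      exact fun hx => hi ⟨x, hx⟩
    simp [this]

lemma measurable_card (k : ℕ) : Measurable fun ω : Config => (G ω k).card := by
  refine measurable_to_countable' fun j => ?_
  have : (fun ω : Config => (G ω k).card) ⁻¹' {j}
      = ⋃ τ ∈ (tr k) '' {t : Config | (G t k).card = j}, {ω | tr k ω = τ} := by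
    ext ω
    simp only [Set.mem_preimage, Set.mem_singleton_iff, Set.mem_iUnion]
    constructor
    · intro h
      exact ⟨tr k ω, ⟨ω, h, rfl⟩, rfl⟩
    · rintro ⟨τ, ⟨t, ht, rfl⟩, hω⟩
      rw [agree_G ((agree_iff_tr k t ω).2 hω) le_rfl]
      exact ht
  rw [this]
  refine MeasurableSet.biUnion (Set.to_countable _) ?_
  rintro _ ⟨t, _, rfl⟩
  simp only [← agree_iff_tr]
  exact measurableSet_D k t

lemma gw_step (q : ℕ → ℝ) (GW : Measure Config) (hGW : IsGW q GW) (X : ENNReal)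
    (ha : ∑' l, ENNReal.ofReal (q l) * X ^ l ≠ ⊤) (k : ℕ) :
    ∫⁻ ω, X ^ (G ω (k+1)).card ∂GW
      = ∫⁻ ω, (∑' l, ENNReal.ofReal (q l) * X ^ l) ^ (G ω k).card ∂GW := by
  have := hGW.1
  apply lintegral_fibers GW (tr k)
  · intro t
    simp only [← agree_iff_tr]
    exact measurableSet_D k t
  intro t
  simp only [← agree_iff_tr]
  have hD := measurableSet_D k t
  let Γ : Config → (G t k → ℕ) := fun ω v => ω v
  have hΓ : Measurable Γ := measurable_pi_lambda _ fun v => measurable_pi_apply _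
  have hGD : GW {ω | agree k t ω} = ∏ v ∈ below t k, ENNReal.ofReal (q (t v)) := by
    rw [← hGW.2 (below t k) t]
    congr 1
    ext ω
    simp [agree, mem_below]
  have hG : ∀ g : G t k → ℕ, GW (Γ ⁻¹' {g} ∩ {ω | agree k t ω})
      = GW {ω | agree k t ω} * ∏ v : G t k, ENNReal.ofReal (q (g v)) := by
    intro g
    have hdis : Disjoint (below t k) (G t k) := by
      rw [Finset.disjoint_left]
      intro v hv hv'
      rw [mem_below] at hv
      rw [mem_G] at hv'
      omega
    have h1 : ∏ v ∈ below t k, ENNReal.ofReal (q (t v))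
        = ∏ v ∈ below t k, ENNReal.ofReal (q (md t k g v)) := by
      refine Finset.prod_congr rfl fun v hv => ?_
      rw [md_apply' _ _ _ (mem_below.1 hv).1]
    have h2 : ∏ v : G t k, ENNReal.ofReal (q (g v))
        = ∏ v ∈ G t k, ENNReal.ofReal (q (md t k g v)) := by
      rw [← Finset.prod_coe_sort (G t k)]
      simp [md_apply]
    rw [hGD, h1, h2, ← Finset.prod_union hdis, ← hGW.2]
    congr 1
    ext ω
    simp only [Set.mem_inter_iff, Set.mem_preimage, Set.mem_singleton_iff, Set.mem_ofPred_eq,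
      Finset.mem_union]
    constructor
    · rintro ⟨h3, h4⟩ v (hv | hv)
      · rw [mem_below] at hv
        rw [md_apply' _ _ _ hv.1, h4 v hv.1 hv.2]
      · have := congrFun h3 ⟨v, hv⟩
        rw [← md_apply t k g] at this
        exact this
    · intro h3
      refine ⟨?_, ?_⟩
      · ext v
        rw [← md_apply t k g]
        exact h3 v (Or.inr v.2)
      · intro v hv hm
        rw [h3 v (Or.inl (mem_below.2 ⟨hv, hm⟩)), md_apply' _ _ _ hv]
  have e1 : ∫⁻ ω in {ω | agree k t ω}, X ^ (G ω (k+1)).card ∂GW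
      = ∫⁻ ω in {ω | agree k t ω}, (fun g : G t k → ℕ => ∏ v, X ^ (g v)) (Γ ω) ∂GW := by
    refine setLIntegral_congr_fun hD fun ω hω => ?_
    simp only [Γ]
    rw [card_G_succ, agree_G hω le_rfl, Finset.prod_pow_eq_pow_sum, ← Finset.sum_coe_sort]
  have e2 : ∫⁻ ω in {ω | agree k t ω}, (∑' l, ENNReal.ofReal (q l) * X ^ l) ^ (G ω k).card ∂GW
      = ∫⁻ ω in {ω | agree k t ω}, (∑' l, ENNReal.ofReal (q l) * X ^ l) ^ (G t k).card ∂GW := by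
    refine setLIntegral_congr_fun hD fun ω hω => ?_
    rw [agree_G hω le_rfl]
  rw [e1, e2, setLIntegral_const,
    ← lintegral_map (f := fun g : G t k → ℕ => ∏ v, X ^ (g v)) (measurable_of_countable _) hΓ,
    lintegral_countable']
  have e3 : ∀ g : G t k → ℕ, (∏ v, X ^ (g v)) * (Measure.map Γ (GW.restrict {ω | agree k t ω})) {g}
      = GW {ω | agree k t ω} * ∏ v : G t k, (ENNReal.ofReal (q (g v)) * X ^ (g v)) := by
    intro g
    rw [Measure.map_apply hΓ (measurableSet_singleton _),
      Measure.restrict_apply (hΓ (measurableSet_singleton _)), hG, Finset.prod_mul_distrib]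
    ring
  simp only [e3]
  rw [ENNReal.tsum_mul_left, tsum_pi (fun _ l => ENNReal.ofReal (q l) * X ^ l) (fun _ => ha)]
  simp [mul_comm]

/-- generating function of q -/
def hh (q : ℕ → ℝ) (x : ℝ) : ℝ := ∑' l, q l * x ^ l


lemma hh_summable (q : ℕ → ℝ) (hq_nonneg : ∀ l, 0 ≤ q l) (hs : Summable q) {x : ℝ}
    (hx : x ∈ Set.Icc (0:ℝ) 1) : Summable fun l => q l * x ^ l :=
  Summable.of_nonneg_of_le (fun l => mul_nonneg (hq_nonneg l) (pow_nonneg hx.1 l))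
    (fun l => mul_le_of_le_one_right (hq_nonneg l) (pow_le_one₀ hx.1 hx.2)) hs

lemma exists_pos (q : ℕ → ℝ) (hq_nonneg : ∀ l, 0 ≤ q l) (hq_sum : ∑' l, q l = 1) : ∃ l, 0 < q l := by
  by_contra! h
  have : q = fun _ => 0 := by ext l; exact le_antisymm (h l) (hq_nonneg l)
  rw [this] at hq_sum
  simp at hq_sum

lemma hh_mem (q : ℕ → ℝ) (hq_nonneg : ∀ l, 0 ≤ q l) (hq_zero : q 0 = 0) (hs : Summable q)
    (hq_sum : ∑' l, q l = 1) {x : ℝ}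
    (hx : x ∈ Set.Ioo (0:ℝ) 1) : hh q x ∈ Set.Ioo (0:ℝ) 1 := by
  have hsx := hh_summable q hq_nonneg hs (Set.Ioo_subset_Icc_self hx)
  constructor
  · obtain ⟨l, hl⟩ := exists_pos q hq_nonneg hq_sum
    exact hsx.tsum_pos (fun i => mul_nonneg (hq_nonneg i) (pow_nonneg hx.1.le i)) l
      (mul_pos hl (pow_pos hx.1 l))
  · have : hh q x ≤ ∑' l, q l * x := by
      refine hsx.tsum_le_tsum (fun l => ?_) (hs.mul_right x)
      rcases Nat.eq_zero_or_pos l with rfl | hl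
      · simp [hq_zero]
      · exact mul_le_mul_of_nonneg_left (pow_le_of_le_one hx.1.le hx.2.le (by omega)) (hq_nonneg l)
    rw [tsum_mul_right, hq_sum, one_mul] at this
    exact this.trans_lt hx.2

lemma hh_deriv_summable (q : ℕ → ℝ) (hq_nonneg : ∀ l, 0 ≤ q l)
    (hm : Summable fun l : ℕ => (l:ℝ) * q l) {x : ℝ}
    (hx : x ∈ Set.Ioo (0:ℝ) 1) : Summable fun l : ℕ => q l * ((l:ℝ) * x ^ (l-1)) := by
  refine Summable.of_nonneg_of_le (fun l => ?_) (fun l => ?_) hm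
  · have := hq_nonneg l
    have := hx.1
    positivity
  · have h1 : x ^ (l-1) ≤ 1 := pow_le_one₀ hx.1.le hx.2.le
    have h2 : 0 ≤ (l:ℝ) * q l := mul_nonneg (Nat.cast_nonneg l) (hq_nonneg l)
    nlinarith

lemma hh_deriv (q : ℕ → ℝ) (hq_nonneg : ∀ l, 0 ≤ q l) (hs : Summable q)
    (hm : Summable fun l : ℕ => (l:ℝ) * q l) {x : ℝ}
    (hx : x ∈ Set.Ioo (0:ℝ) 1) :
    HasDerivAt (hh q) (∑' l : ℕ, q l * ((l:ℝ) * x ^ (l-1))) x := by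
  refine hasDerivAt_tsum_of_isPreconnected (g := fun l x => q l * x ^ l)
    (g' := fun l x => q l * ((l:ℝ) * x ^ (l-1))) hm isOpen_Ioo isPreconnected_Ioo
    (fun l y _ => (hasDerivAt_pow l y).const_mul (q l)) (fun l y hy => ?_) hx
    (hh_summable q hq_nonneg hs (Set.Ioo_subset_Icc_self hx)) hx
  have h1 : y ^ (l-1) ≤ 1 := pow_le_one₀ hy.1.le hy.2.le
  have h2 : 0 ≤ (l:ℝ) * q l := mul_nonneg (Nat.cast_nonneg l) (hq_nonneg l)
  have h3 : 0 ≤ y ^ (l-1) := pow_nonneg hy.1.le _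
  rw [Real.norm_of_nonneg]
  · nlinarith
  · nlinarith [mul_nonneg h2 h3]

lemma hh_deriv_pos (q : ℕ → ℝ) (hq_nonneg : ∀ l, 0 ≤ q l) (hq_zero : q 0 = 0)
    (hq_sum : ∑' l, q l = 1)
    (hm : Summable fun l : ℕ => (l:ℝ) * q l) {x : ℝ}
    (hx : x ∈ Set.Ioo (0:ℝ) 1) : 0 < ∑' l : ℕ, q l * ((l:ℝ) * x ^ (l-1)) := by
  obtain ⟨l, hl⟩ := exists_pos q hq_nonneg hq_sum
  have hx0 := hx.1
  refine (hh_deriv_summable q hq_nonneg hm hx).tsum_pos (fun i => ?_) l ?_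
  · have := hq_nonneg i
    positivity
  · have : 0 < l := by
      rcases Nat.eq_zero_or_pos l with rfl | h
      · exact absurd hq_zero hl.ne'
      · exact h
    positivity

lemma pgf_lint (GW : Measure Config) [IsProbabilityMeasure GW] (k : ℕ) {x : ℝ} (hx : 0 ≤ x) :
    pgf GW k x = (∫⁻ ω, (ENNReal.ofReal x) ^ (G ω k).card ∂GW).toReal := by
  unfold pgf
  rw [integral_eq_lintegral_of_nonneg_ae]
  · simp only [Z_eq, ENNReal.ofReal_pow hx]
  · exact Filter.Eventually.of_forall fun ω => pow_nonneg hx _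
  · simp only [Z_eq]
    exact ((measurable_of_countable (fun n : ℕ => x ^ n)).comp
      (measurable_card k)).aestronglyMeasurable

lemma pgf_zero (GW : Measure Config) [IsProbabilityMeasure GW] (x : ℝ) : pgf GW 0 x = x := by
  simp [pgf, Z_eq, G_zero]

lemma hh_ofReal (q : ℕ → ℝ) (hq_nonneg : ∀ l, 0 ≤ q l) (hs : Summable q) {x : ℝ}
    (hx : x ∈ Set.Icc (0:ℝ) 1) :
    ∑' l, ENNReal.ofReal (q l) * (ENNReal.ofReal x) ^ l = ENNReal.ofReal (hh q x) := by
  unfold hh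
  rw [ENNReal.ofReal_tsum_of_nonneg (fun l => mul_nonneg (hq_nonneg l) (pow_nonneg hx.1 l))
    (hh_summable q hq_nonneg hs hx)]
  refine tsum_congr fun l => ?_
  rw [ENNReal.ofReal_mul (hq_nonneg l), ENNReal.ofReal_pow hx.1]

lemma pgf_succ (q : ℕ → ℝ) (hq_nonneg : ∀ l, 0 ≤ q l) (hs : Summable q)
    (GW : Measure Config) (hGW : IsGW q GW) (k : ℕ) {x : ℝ}
    (hx : x ∈ Set.Icc (0:ℝ) 1) : pgf GW (k+1) x = pgf GW k (hh q x) := by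
  have := hGW.1
  have h0 : 0 ≤ hh q x := tsum_nonneg fun l => mul_nonneg (hq_nonneg l) (pow_nonneg hx.1 l)
  rw [pgf_lint GW _ hx.1, pgf_lint GW _ h0, ← hh_ofReal q hq_nonneg hs hx, gw_step q GW hGW]
  rw [hh_ofReal q hq_nonneg hs hx]
  simp

lemma pgf_succ_deriv (q : ℕ → ℝ) (hq_nonneg : ∀ l, 0 ≤ q l) (hs : Summable q)
    (hm : Summable fun l : ℕ => (l:ℝ) * q l)
    (GW : Measure Config) (hGW : IsGW q GW) (k : ℕ) {x : ℝ}
    (hx : x ∈ Set.Ioo (0:ℝ) 1) (hd : DifferentiableAt ℝ (pgf GW k) (hh q x)) :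
    HasDerivAt (pgf GW (k+1))
      (deriv (pgf GW k) (hh q x) * ∑' l : ℕ, q l * ((l:ℝ) * x ^ (l-1))) x := by
  refine HasDerivAt.congr_of_eventuallyEq
    (hd.hasDerivAt.comp x (hh_deriv q hq_nonneg hs hm hx)) ?_
  filter_upwards [isOpen_Ioo.mem_nhds hx] with y hy
  exact pgf_succ q hq_nonneg hs GW hGW k (Set.Ioo_subset_Icc_self hy)

lemma pgf_deriv (q : ℕ → ℝ) (hq_nonneg : ∀ l, 0 ≤ q l) (hq_zero : q 0 = 0) (hs : Summable q)
    (hq_sum : ∑' l, q l = 1) (hm : Summable fun l : ℕ => (l:ℝ) * q l)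
    (GW : Measure Config) (hGW : IsGW q GW) (k : ℕ) : ∀ x ∈ Set.Ioo (0:ℝ) 1,
    DifferentiableAt ℝ (pgf GW k) x ∧ 0 < deriv (pgf GW k) x := by
  have := hGW.1
  induction k with
  | zero =>
    intro x _
    have : pgf GW 0 = fun x => x := by ext x; exact pgf_zero GW x
    rw [this]
    simp
  | succ k ih =>
    intro x hx
    have h1 := ih _ (hh_mem q hq_nonneg hq_zero hs hq_sum hx)
    have h2 := pgf_succ_deriv q hq_nonneg hs hm GW hGW k hx h1.1
    refine ⟨h2.differentiableAt, ?_⟩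
    rw [h2.deriv]
    exact mul_pos h1.2 (hh_deriv_pos q hq_nonneg hq_zero hq_sum hm hx)


/-- Under the spine construction, conditionally on the first `n` generations `𝕋_n` of the
tree, the spine vertex `ξ_n` is uniformly distributed on the `n`-th generation: for every
tree `t` and every vertex `u` of `t` at generation `n`,
`P(ξ_n = u | 𝕋_n = T_n) = 1 / Z_n(T_n)`. -/
theorem spine_vertex_uniform_given_tree
    (q : ℕ → ℝ) (hq_nonneg : ∀ ℓ, 0 ≤ q ℓ) (hq_zero : q 0 = 0) (hq_sum : ∑' ℓ, q ℓ = 1)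
    (m : ℝ) (hm_def : m = ∑' ℓ : ℕ, (ℓ : ℝ) * q ℓ) (hm_one : 1 < m)
    (GW : Measure Config) (hGW : IsGW q GW)
    (s : ℝ) (hs : s ∈ Set.Ioo (0 : ℝ) 1)
    (φinv : ℕ → ℝ → ℝ)
    (hφinv : ∀ n, ∀ x ∈ Set.Ioo (0 : ℝ) 1,
      φinv n x ∈ Set.Ioo (0 : ℝ) 1 ∧ pgf GW n (φinv n x) = x)
    (hφinv_left : ∀ n, ∀ y ∈ Set.Ioo (0 : ℝ) 1, φinv n (pgf GW n y) = y)
    (c : ℕ → ℝ) (hc : ∀ n, c n = -1 / Real.log (φinv n s))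
    (P : Measure (Config × (ℕ → ℕ)))
    (hP : IsSpineLaw (tq q c) (tqs q c GW φinv s) P)
    (n : ℕ) (t : Config) (u : List ℕ) (hu_len : u.length = n) (hu_mem : memTree t u) :
    P {p | (∀ v : List ℕ, v.length < n → memTree t v → p.1 v = t v) ∧
           rayVertex p.2 n = u}
      = ((Z t [] n : ENNReal))⁻¹
        * P {p | ∀ v : List ℕ, v.length < n → memTree t v → p.1 v = t v} := by
  have hGWp := hGW.1
  have hPp := hP.1
  have hsm : Summable q := by
    by_contra h
    rw [tsum_eq_zero_of_not_summable h] at hq_sum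
    exact zero_ne_one hq_sum
  have hm : Summable fun l : ℕ => (l:ℝ) * q l := by
    by_contra h
    rw [tsum_eq_zero_of_not_summable h] at hm_def
    linarith
  have hx : ∀ k, φinv k s ∈ Set.Ioo (0:ℝ) 1 := fun k => (hφinv k s hs).1
  have hstep : ∀ k, hh q (φinv (k+1) s) = φinv k s := by
    intro k
    have h1 := hφinv_left k _ (hh_mem q hq_nonneg hq_zero hsm hq_sum (hx (k+1)))
    rw [← pgf_succ q hq_nonneg hsm GW hGW k (Set.Ioo_subset_Icc_self (hx (k+1))),
      (hφinv (k+1) s hs).2] at h1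
    exact h1.symm
  have hpd := pgf_deriv q hq_nonneg hq_zero hsm hq_sum hm GW hGW
  have hinv : ∀ k, 1 / c k = - Real.log (φinv k s) := by
    intro k
    rw [hc k, one_div_div, div_neg, div_one]
  have htq : ∀ k l, tq q c k l = q l * (φinv (k+1) s) ^ l * (φinv k s)⁻¹ := by
    intro k l
    have e1 : Real.exp (1 / c k) = (φinv k s)⁻¹ := by
      rw [hinv, Real.exp_neg, Real.exp_log (hx k).1]
    have e2 : Real.exp (-(l:ℝ) / c (k+1)) = (φinv (k+1) s) ^ l := by
      have : -(l:ℝ) / c (k+1) = l * Real.log (φinv (k+1) s) := by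
        rw [div_eq_mul_one_div, hinv]; ring
      rw [this, Real.exp_nat_mul, Real.exp_log (hx (k+1)).1]
    rw [tq, e1, e2]; ring
  let r : ℕ → ℝ := fun k => φinv k s * (φinv (k+1) s)⁻¹ *
    (deriv (pgf GW k) (φinv k s) / deriv (pgf GW (k + 1)) (φinv (k + 1) s))
  have hr0 : ∀ k, 0 ≤ r k := by
    intro k
    have a1 := (hx k).1
    have a2 := (hx (k+1)).1
    have a3 := (hpd k _ (hx k)).2
    have a4 := (hpd (k+1) _ (hx (k+1))).2
    simp only [r]
    positivity
  have htq0 : ∀ k l, 0 ≤ tq q c k l := by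
    intro k l
    have := hq_nonneg l
    unfold tq
    positivity
  have htqs : ∀ k l, tqs q c GW φinv s k l = r k * l * tq q c k l := by
    intro k l
    have a1 := (hx k).1.ne'
    have a2 := (hx (k+1)).1.ne'
    have e2 : Real.exp (-((l:ℝ) - 1) / c (k+1)) = (φinv (k+1) s) ^ l * (φinv (k+1) s)⁻¹ := by
      have : -((l:ℝ) - 1) / c (k+1) = l * Real.log (φinv (k+1) s) + -Real.log (φinv (k+1) s) := by
        rw [div_eq_mul_one_div, hinv]; ring
      rw [this, Real.exp_add, Real.exp_neg, Real.exp_nat_mul, Real.exp_log (hx (k+1)).1]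
    rw [tqs, e2, htq]
    simp only [r]
    field_simp
  have hQ : ∀ k, ∑' l, ENNReal.ofReal (tq q c k l) = 1 := by
    intro k
    have hS := hh_summable q hq_nonneg hsm (Set.Ioo_subset_Icc_self (hx (k+1)))
    have e : tq q c k = fun l => q l * (φinv (k+1) s) ^ l * (φinv k s)⁻¹ := funext (htq k)
    rw [← ENNReal.ofReal_tsum_of_nonneg (htq0 k) (by rw [e]; exact hS.mul_right _), e,
      tsum_mul_right]
    have : ∑' l, q l * (φinv (k+1) s) ^ l = φinv k s := hstep k
    rw [this, mul_inv_cancel₀ (hx k).1.ne', ENNReal.ofReal_one]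
  have hr : ∀ k, ∑' l : ℕ, ENNReal.ofReal (r k) * l * ENNReal.ofReal (tq q c k l) = 1 := by
    intro k
    have hS := hh_deriv_summable q hq_nonneg hm (hx (k+1))
    have hD := (pgf_succ_deriv q hq_nonneg hsm hm GW hGW k (hx (k+1))
      (by rw [hstep]; exact (hpd k _ (hx k)).1)).deriv
    rw [hstep] at hD
    have hne := (hpd (k+1) _ (hx (k+1))).2.ne'
    have e0 : ∀ l : ℕ, ENNReal.ofReal (r k) * l * ENNReal.ofReal (tq q c k l)
        = ENNReal.ofReal (q l * ((l:ℝ) * (φinv (k+1) s) ^ (l-1)) *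
          (deriv (pgf GW k) (φinv k s) / deriv (pgf GW (k + 1)) (φinv (k + 1) s))) := by
      intro l
      rw [← ENNReal.ofReal_natCast l, ← ENNReal.ofReal_mul (hr0 k),
        ← ENNReal.ofReal_mul (mul_nonneg (hr0 k) (Nat.cast_nonneg l)), htq]
      congr 1
      have a1 := (hx k).1.ne'
      have a2 := (hx (k+1)).1.ne'
      simp only [r]
      cases l with
      | zero => simp
      | succ l =>
        simp only [Nat.add_sub_cancel, pow_succ]
        field_simp
    simp only [e0]
    rw [← ENNReal.ofReal_tsum_of_nonneg _ (hS.mul_right _), tsum_mul_right, ← mul_div_assoc,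
      mul_comm, ← hD, div_self hne, ENNReal.ofReal_one]
    intro l
    have a0 := hq_nonneg l
    have a2 := (hx (k+1)).1
    have a3 := (hpd k _ (hx k)).2
    have a4 := (hpd (k+1) _ (hx (k+1))).2
    positivity
  have hlaw : ∀ n t u, inTree n t u → P (Cy n t u)
      = ∏ k ∈ Finset.range n,
        (ENNReal.ofReal (r k) * ∏ v ∈ G t k, ENNReal.ofReal (tq q c k (t v))) := by
    intro n t u h
    refine (hP.2 n t u h).trans ?_
    refine Finset.prod_congr rfl fun k hk => ?_
    rw [Finset.mem_range] at hk
    have hmem : rayVertex u k ∈ G t k := mem_G.2 ⟨rayVertex_length _ _,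
      (inTree_iff k t u).1 fun j hj => h j (by omega)⟩
    have hpos : (t (rayVertex u k) : ℝ) ≠ 0 := by
      have := h k hk
      exact_mod_cast (by omega : t (rayVertex u k) ≠ 0)
    have hset : genSet t k \ {rayVertex u k} = ((G t k).erase (rayVertex u k) : Finset (List ℕ)) := by
      ext v
      simp [G]
    rw [hset, finprod_mem_coe_finset, htqs, ← ENNReal.ofReal_prod_of_nonneg (fun v _ => htq0 k _),
      ← ENNReal.ofReal_mul (hr0 k), ← Finset.mul_prod_erase _ _ hmem]
    congr 1
    field_simp
  exact spine_final P _ _ hlaw hQ hr n t u (mem_G.2 ⟨hu_len, hu_mem⟩)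

end
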